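/- arXiv:1609.03465 — 3 statements merged into one kernel-verified Lean document; each statement's English description precedes it below -/
import Mathlib

section
/- Lemma 4: Under Assumption 2, let H be any n×n row-stochastic matrix with H i i > 0 for all i ∈ V, and set Φ = H·Ψ. Write Vf = {i : ξᵢ = 0}, Vp = {i : 0 < ξᵢ < 1}, Vs = Vf ∪ Vp, and let Φ' be the Vs×Vs nonnegative matrix with Φ' i j = H i j when i ∈ Vf and Φ' i j = W i j when i ∈ Vp (for j ∈ Vs). If G(Φ') contains a spanning tree — i.e., there exists r ∈ Vs such that for every v ∈ Vs with v ≠ r there is m ≥ 1 with (Φ'^m) v r > 0 — then Φ₁, the Vs×Vs submatrix of Φ, is row-stochastic and SIA: there exists an entrywise nonnegative vector ν indexed by Vs with Σ_{v∈Vs} ν_v = 1 such that Φ₁^k converges entrywise, as k → ∞, to the matrix each of whose rows equals ν. -/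
open Matrix Filter Finset

/-- `S` is an independent strongly connected component of the influence graph `G(W)`
(edge from `j` to `i` iff `W i j ≠ 0`): nonempty, in-closed and strongly connected. -/
def IsISCC {n : ℕ} (W : Matrix (Fin n) (Fin n) ℝ) (S : Set (Fin n)) : Prop :=
  S.Nonempty ∧ (∀ i ∈ S, ∀ j, W i j ≠ 0 → j ∈ S) ∧
    (∀ i ∈ S, ∀ j ∈ S, i ≠ j → ∃ m, 1 ≤ m ∧ 0 < (W ^ m) i j)

/-- Assumption 2: every ISCC of `G(W)` contains at least one stubborn agent. -/
def Assumption2 {n : ℕ} (W : Matrix (Fin n) (Fin n) ℝ) (ξ : Fin n → ℝ) : Prop :=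
  ∀ S : Set (Fin n), IsISCC W S → ∃ i ∈ S, ξ i < 1

/-- A positive entry of a product of nonnegative matrices comes from a walk of length two. -/
lemma mul_apply_pos_iff_exists {ι : Type*} [Fintype ι] {A B : Matrix ι ι ℝ}
    (hA : ∀ i j, 0 ≤ A i j) (hB : ∀ i j, 0 ≤ B i j) {i j : ι} :
    0 < (A * B) i j ↔ ∃ k, 0 < A i k ∧ 0 < B k j := by
  rw [Matrix.mul_apply, Finset.sum_pos_iff_of_nonneg fun k _ => mul_nonneg (hA i k) (hB k j)]
  refine ⟨fun ⟨k, _, hk⟩ => ⟨k, ?_, ?_⟩, fun ⟨k, h₁, h₂⟩ => ⟨k, Finset.mem_univ k, mul_pos h₁ h₂⟩⟩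
  · exact (hA i k).lt_of_ne' (left_ne_zero_of_mul hk.ne')
  · exact (hB k j).lt_of_ne' (right_ne_zero_of_mul hk.ne')

/-- Positivity of an entry of a power is inherited by any matrix with at least as many edges. -/
lemma pow_apply_pos_of_apply_pos_imp {ι : Type*} [Fintype ι] [DecidableEq ι] {A B : Matrix ι ι ℝ}
    (hA : ∀ i j, 0 ≤ A i j) (hB : ∀ i j, 0 ≤ B i j) (h : ∀ i j, 0 < A i j → 0 < B i j)
    (m : ℕ) {i j : ι} (hm : 0 < (A ^ m) i j) : 0 < (B ^ m) i j := by
  induction m generalizing j with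
  | zero => simpa using hm
  | succ m ih =>
    rw [pow_succ] at hm ⊢
    obtain ⟨k, h₁, h₂⟩ := (mul_apply_pos_iff_exists (pow_apply_nonneg hA m) hA).1 hm
    exact (mul_apply_pos_iff_exists (pow_apply_nonneg hB m) hB).2 ⟨k, ih h₁, h k j h₂⟩

/-- If every state can reach `r` and `r` has a self-loop, some power has positive column `r`. -/
lemma exists_pow_apply_pos_of_reachable {ι : Type*} [Fintype ι] [DecidableEq ι]
    {A : Matrix ι ι ℝ} (hA : ∀ i j, 0 ≤ A i j) {r : ι} (hr : 0 < A r r)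
    (h : ∀ v, ∃ m, 0 < (A ^ m) v r) : ∃ N, ∀ v, 0 < (A ^ N) v r := by
  choose f hf using h
  refine ⟨Finset.univ.sup f, fun v => ?_⟩
  refine Nat.le_induction (hf v) (fun m _ hm => ?_) _ (Finset.le_sup (Finset.mem_univ v))
  rw [pow_succ]
  exact (mul_apply_pos_iff_exists (pow_apply_nonneg hA m) hA).2 ⟨r, hm, hr⟩

/-- If a row-stochastic matrix puts weight at least `δ` on the state `r` from the state `i`, the
weighted average in row `i` of values bounded by `M` is at most `δ * x r + (1 - δ) * M`. -/
lemma sum_mul_le_of_le_apply {ι : Type*} [Fintype ι] {B : Matrix ι ι ℝ}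
    (hB : ∀ i j, 0 ≤ B i j) (hB1 : ∀ i, ∑ j, B i j = 1) {r i : ι} {δ M : ℝ} (hδ : δ ≤ B i r)
    {x : ι → ℝ} (hx : ∀ j, x j ≤ M) : ∑ j, B i j * x j ≤ δ * x r + (1 - δ) * M := by
  have h₁ : B i r * (M - x r) ≤ ∑ j, B i j * (M - x j) :=
    Finset.single_le_sum (f := fun j => B i j * (M - x j))
      (fun j _ => mul_nonneg (hB i j) (sub_nonneg.2 (hx j))) (Finset.mem_univ r)
  have h₂ : ∑ j, B i j * (M - x j) = M - ∑ j, B i j * x j := by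
    simp [mul_sub, Finset.sum_sub_distrib, ← Finset.sum_mul, hB1]
  nlinarith [mul_le_mul_of_nonneg_right hδ (sub_nonneg.2 (hx r))]

/-- For a row-stochastic matrix with a power that has a positive column, each column of the
powers converges to a constant vector. -/
lemma exists_tendsto_pow_apply {ι : Type*} [Fintype ι] [DecidableEq ι] {A : Matrix ι ι ℝ}
    (hA : A ∈ rowStochastic ℝ ι) {N : ℕ} {r : ι} (hN : ∀ v, 0 < (A ^ N) v r) (b : ι) :
    ∃ L, ∀ a, Tendsto (fun k => (A ^ k) a b) atTop (nhds L) := by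
  have : Nonempty ι := ⟨r⟩
  have hP (k : ℕ) := mem_rowStochastic_iff_sum.1 (pow_mem hA k)
  set M : ℕ → ℝ := fun k => ⨆ i, (A ^ k) i b
  set m : ℕ → ℝ := fun k => ⨅ i, (A ^ k) i b
  have hM (k : ℕ) (i : ι) : (A ^ k) i b ≤ M k :=
    le_ciSup (f := fun i => (A ^ k) i b) (Set.finite_range _).bddAbove i
  have hm (k : ℕ) (i : ι) : m k ≤ (A ^ k) i b :=
    ciInf_le (f := fun i => (A ^ k) i b) (Set.finite_range _).bddBelow i
  obtain ⟨v₀, hv₀⟩ := Finite.exists_min fun v => (A ^ N) v r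
  set δ := (A ^ N) v₀ r
  have hδ : 0 < δ := hN v₀
  have hup {l : ℕ} {ε : ℝ} (h : ∀ v, ε ≤ (A ^ l) v r) (k : ℕ) :
      M (k + l) ≤ ε * (A ^ k) r b + (1 - ε) * M k := by
    refine ciSup_le fun i => ?_
    rw [add_comm k l, pow_add, Matrix.mul_apply]
    exact sum_mul_le_of_le_apply (hP l).1 (hP l).2 (h i) (x := fun j => (A ^ k) j b) (hM k)
  have hlow {l : ℕ} {ε : ℝ} (h : ∀ v, ε ≤ (A ^ l) v r) (k : ℕ) :
      ε * (A ^ k) r b + (1 - ε) * m k ≤ m (k + l) := by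
    refine le_ciInf fun i => ?_
    rw [add_comm k l, pow_add, Matrix.mul_apply]
    have := sum_mul_le_of_le_apply (hP l).1 (hP l).2 (h i) (x := fun j => -(A ^ k) j b)
      (fun j => neg_le_neg (hm k j))
    simp only [mul_neg, Finset.sum_neg_distrib] at this
    linarith
  have hManti : Antitone M := antitone_nat_of_succ_le fun k => by
    simpa using hup (l := 1) (ε := 0) (fun v => (hP 1).1 v r) k
  have hmmono : Monotone m := monotone_nat_of_le_succ fun k => by
    simpa using hlow (l := 1) (ε := 0) (fun v => (hP 1).1 v r) k
  have hML : Tendsto M atTop (nhds (⨅ k, M k)) := tendsto_atTop_ciInf hManti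
    ⟨0, by rintro _ ⟨k, rfl⟩; exact ((hP k).1 r b).trans (hM k r)⟩
  have hmL : Tendsto m atTop (nhds (⨆ k, m k)) := tendsto_atTop_ciSup hmmono
    ⟨1, by rintro _ ⟨k, rfl⟩; exact (hm k r).trans (le_one_of_mem_rowStochastic (pow_mem hA k))⟩
  have hgap : (⨅ k, M k) - (⨆ k, m k) ≤ (1 - δ) * ((⨅ k, M k) - (⨆ k, m k)) := by
    refine le_of_tendsto_of_tendsto' (((tendsto_add_atTop_iff_nat N).2 hML).sub
      ((tendsto_add_atTop_iff_nat N).2 hmL)) ((hML.sub hmL).const_mul (1 - δ)) fun k => ?_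
    linarith [hup hv₀ k, hlow hv₀ k]
  have hle : (⨆ k, m k) ≤ ⨅ k, M k :=
    le_of_tendsto_of_tendsto' hmL hML fun k => (hm k r).trans (hM k r)
  have heq : (⨆ k, m k) = ⨅ k, M k := by nlinarith
  exact ⟨⨅ k, M k, fun a => tendsto_of_tendsto_of_tendsto_of_le_of_le (heq ▸ hmL) hML
    (fun k => hm k a) (fun k => hM k a)⟩

/-- A row-stochastic matrix with a power that has a positive column is SIA. -/
lemma exists_tendsto_pow_of_pos_column {ι : Type*} [Fintype ι] [DecidableEq ι] {A : Matrix ι ι ℝ}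
    (hA : A ∈ rowStochastic ℝ ι) {N : ℕ} {r : ι} (hN : ∀ v, 0 < (A ^ N) v r) :
    ∃ ν : ι → ℝ, (∀ v, 0 ≤ ν v) ∧ (∑ v, ν v = 1) ∧
      ∀ a b, Tendsto (fun k => (A ^ k) a b) atTop (nhds (ν b)) := by
  choose ν hν using exists_tendsto_pow_apply hA hN
  refine ⟨ν, fun v => ge_of_tendsto' (hν v r) fun k => (pow_mem hA k).1 r v, ?_,
    fun a b => hν b a⟩
  refine tendsto_nhds_unique (tendsto_finsetSum Finset.univ fun v _ => hν v r) ?_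
  simp [fun k => sum_row_of_mem_rowStochastic (pow_mem hA k) r]

/-- Every nonempty in-closed set of agents contains an ISCC. -/
lemma exists_isISCC_subset {n : ℕ} {W : Matrix (Fin n) (Fin n) ℝ}
    (hW0 : ∀ i j, 0 ≤ W i j) (hW1 : ∀ i, ∑ j, W i j = 1) {S : Set (Fin n)} (hS : S.Nonempty)
    (hcl : ∀ i ∈ S, ∀ j, W i j ≠ 0 → j ∈ S) : ∃ T ⊆ S, IsISCC W T := by
  obtain ⟨T, hTS, hT⟩ := (Set.toFinite
    {T : Set (Fin n) | T.Nonempty ∧ ∀ i ∈ T, ∀ j, W i j ≠ 0 → j ∈ T}).exists_le_minimal ⟨hS, hcl⟩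
  refine ⟨T, hTS, hT.prop.1, hT.prop.2, fun i hi j hj _ => ?_⟩
  set R : Set (Fin n) := {j | ∃ m, 1 ≤ m ∧ 0 < (W ^ m) i j}
  have hRT : R ⊆ T := by
    rintro k ⟨m, -, hm⟩
    induction m generalizing k with
    | zero =>
      rcases eq_or_ne i k with rfl | h
      · exact hi
      · simp [h] at hm
    | succ m ih =>
      rw [pow_succ, mul_apply_pos_iff_exists (pow_apply_nonneg hW0 m) hW0] at hm
      obtain ⟨l, h₁, h₂⟩ := hm
      exact hT.prop.2 l (ih h₁) k h₂.ne'
  refine hT.le_of_le ⟨?_, ?_⟩ hRT hj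
  · obtain ⟨j, -, hj⟩ := (Finset.sum_pos_iff_of_nonneg fun j _ => hW0 i j).1
      ((hW1 i).symm ▸ one_pos : 0 < ∑ j, W i j)
    exact ⟨j, 1, le_rfl, by simpa using hj⟩
  · rintro k ⟨m, -, hk⟩ j hj
    refine ⟨m + 1, by omega, ?_⟩
    rw [pow_succ, mul_apply_pos_iff_exists (pow_apply_nonneg hW0 m) hW0]
    exact ⟨k, hk, (hW0 k j).lt_of_ne' hj⟩

/-- Minimum principle: under Assumption 2, `(I - ΞW)x ≥ 0` implies `x ≥ 0`. -/
lemma nonneg_of_nonneg_one_sub_mulVec {n : ℕ} {W : Matrix (Fin n) (Fin n) ℝ} {ξ : Fin n → ℝ}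
    (hW0 : ∀ i j, 0 ≤ W i j) (hW1 : ∀ i, ∑ j, W i j = 1) (hξ : ∀ i, 0 ≤ ξ i ∧ ξ i ≤ 1)
    (hA2 : Assumption2 W ξ) {x : Fin n → ℝ}
    (hx : ∀ i, 0 ≤ ((1 - Matrix.diagonal ξ * W) *ᵥ x) i) (i : Fin n) : 0 ≤ x i := by
  have : Nonempty (Fin n) := ⟨i⟩
  obtain ⟨p, hp⟩ := Finite.exists_min x
  refine le_trans ?_ (hp i)
  by_contra! hneg
  have hx' (i : Fin n) : ξ i * ∑ j, W i j * x j ≤ x i := by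
    have h := hx i
    rw [Matrix.sub_mulVec, Matrix.one_mulVec, ← Matrix.mulVec_mulVec, Pi.sub_apply,
      Matrix.mulVec_diagonal] at h
    exact sub_nonneg.1 h
  have havg (i : Fin n) : ∑ j, W i j * (x j - x p) = (∑ j, W i j * x j) - x p := by
    simp [mul_sub, Finset.sum_sub_distrib, ← Finset.sum_mul, hW1]
  have hterm (i j : Fin n) : 0 ≤ W i j * (x j - x p) :=
    mul_nonneg (hW0 i j) (sub_nonneg.2 (hp j))
  have hkey (i : Fin n) (hi : x i = x p) : ξ i = 1 ∧ ∑ j, W i j * (x j - x p) = 0 := by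
    have h₁ := hx' i
    have h₂ := Finset.sum_nonneg fun j (_ : j ∈ Finset.univ) => hterm i j
    have h₃ : ξ i = 1 := by
      refine le_antisymm (hξ i).2 ?_
      nlinarith [mul_nonneg (hξ i).1 h₂, havg i]
    rw [h₃] at h₁
    exact ⟨h₃, by linarith [havg i]⟩
  obtain ⟨T, hTS, hT⟩ := exists_isISCC_subset hW0 hW1 (S := {i | x i = x p}) ⟨p, rfl⟩
    fun i hi j hj => by
      have h := (Finset.sum_eq_zero_iff_of_nonneg fun j _ => hterm i j).1 (hkey i hi).2 j
        (Finset.mem_univ j)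
      exact sub_eq_zero.1 ((mul_eq_zero.1 h).resolve_left hj)
  obtain ⟨i, hiT, hi⟩ := hA2 T hT
  exact hi.ne (hkey i (hTS hiT)).1

/-- Under Assumption 2, `I - ΞW` is invertible. -/
lemma isUnit_one_sub_of_assumption2 {n : ℕ} {W : Matrix (Fin n) (Fin n) ℝ} {ξ : Fin n → ℝ}
    (hW0 : ∀ i j, 0 ≤ W i j) (hW1 : ∀ i, ∑ j, W i j = 1) (hξ : ∀ i, 0 ≤ ξ i ∧ ξ i ≤ 1)
    (hA2 : Assumption2 W ξ) : IsUnit (1 - Matrix.diagonal ξ * W) := by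
  refine Matrix.mulVec_injective_iff_isUnit.1 fun x y hxy => funext fun i => ?_
  have key (u v : Fin n → ℝ) (h : (1 - Matrix.diagonal ξ * W) *ᵥ u =
      (1 - Matrix.diagonal ξ * W) *ᵥ v) (i : Fin n) : 0 ≤ (u - v) i :=
    nonneg_of_nonneg_one_sub_mulVec hW0 hW1 hξ hA2
      (fun i => by rw [Matrix.mulVec_sub, h, sub_self, Pi.zero_apply]) i
  exact le_antisymm (sub_nonneg.1 (key y x hxy.symm i)) (sub_nonneg.1 (key x y hxy i))

/-- The matrix `Ψ = (I - ΞW)⁻¹(I - Ξ)` is row-stochastic. -/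
lemma inv_mul_mem_rowStochastic {n : ℕ} {W : Matrix (Fin n) (Fin n) ℝ} {ξ : Fin n → ℝ}
    (hW0 : ∀ i j, 0 ≤ W i j) (hW1 : ∀ i, ∑ j, W i j = 1) (hξ : ∀ i, 0 ≤ ξ i ∧ ξ i ≤ 1)
    (hA2 : Assumption2 W ξ) :
    (1 - Matrix.diagonal ξ * W)⁻¹ * (1 - Matrix.diagonal ξ) ∈ rowStochastic ℝ (Fin n) := by
  have hU := (Matrix.isUnit_iff_isUnit_det _).1 (isUnit_one_sub_of_assumption2 hW0 hW1 hξ hA2)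
  refine mem_rowStochastic.2 ⟨fun i j => ?_, ?_⟩
  · refine nonneg_of_nonneg_one_sub_mulVec hW0 hW1 hξ hA2
      (x := ((1 - Matrix.diagonal ξ * W)⁻¹ * (1 - Matrix.diagonal ξ)).col j) (fun i => ?_) i
    change 0 ≤ ((1 - Matrix.diagonal ξ * W) *
      ((1 - Matrix.diagonal ξ * W)⁻¹ * (1 - Matrix.diagonal ξ))) i j
    rw [Matrix.mul_nonsing_inv_cancel_left _ _ hU, Matrix.sub_apply, Matrix.one_apply,
      Matrix.diagonal_apply]
    split_ifs <;> simp [(hξ i).2]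
  · have hW : W *ᵥ 1 = 1 := (mem_rowStochastic_iff_sum.2 ⟨hW0, hW1⟩).2
    have h : (1 - Matrix.diagonal ξ) *ᵥ (1 : Fin n → ℝ) = (1 - Matrix.diagonal ξ * W) *ᵥ 1 := by
      rw [Matrix.sub_mulVec, Matrix.sub_mulVec, ← Matrix.mulVec_mulVec, hW]
    rw [← Matrix.mulVec_mulVec, h, Matrix.mulVec_mulVec, Matrix.nonsing_inv_mul _ hU,
      Matrix.one_mulVec]

/-- Lemma 4: under Assumption 2, if the graph of `Φ'` (rows of `H` at fully stubborn
agents, rows of `W` at partially stubborn agents, restricted to the stubborn agents)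
has a spanning tree, then the stubborn-agents submatrix `Φ₁` of `Φ = HΨ` is
row-stochastic and SIA. -/
theorem phi1_SIA_of_spanning_tree
    (n : ℕ) (hn : 1 ≤ n)
    (W Ξ : Matrix (Fin n) (Fin n) ℝ) (ξ : Fin n → ℝ)
    (hW0 : ∀ i j, 0 ≤ W i j) (hW1 : ∀ i, ∑ j, W i j = 1)
    (hΞ : Ξ = Matrix.diagonal ξ) (hξ : ∀ i, 0 ≤ ξ i ∧ ξ i ≤ 1)
    (hA2 : Assumption2 W ξ)
    (H : Matrix (Fin n) (Fin n) ℝ)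
    (hH0 : ∀ i j, 0 ≤ H i j) (hH1 : ∀ i, ∑ j, H i j = 1)
    (hHd : ∀ i, 0 < H i i)
    (Φ' : Matrix {i : Fin n // ξ i < 1} {i : Fin n // ξ i < 1} ℝ)
    (hΦ' : ∀ a b, Φ' a b = if ξ (a : Fin n) = 0 then H a.1 b.1 else W a.1 b.1)
    (Φ₁ : Matrix {i : Fin n // ξ i < 1} {i : Fin n // ξ i < 1} ℝ)
    (hΦ₁ : ∀ a b, Φ₁ a b = (H * ((1 - Ξ * W)⁻¹ * (1 - Ξ))) a.1 b.1)
    (htree : ∃ r : {i : Fin n // ξ i < 1}, ∀ v, v ≠ r → ∃ m, 1 ≤ m ∧ 0 < (Φ' ^ m) v r) :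
    ((∀ a b, 0 ≤ Φ₁ a b) ∧ (∀ a, ∑ b, Φ₁ a b = 1)) ∧
    ∃ ν : {i : Fin n // ξ i < 1} → ℝ,
      (∀ v, 0 ≤ ν v) ∧ (∑ v, ν v = 1) ∧
      ∀ a b, Tendsto (fun k => (Φ₁ ^ k) a b) atTop (nhds (ν b)) := by
  subst hΞ
  set Ψ := (1 - Matrix.diagonal ξ * W)⁻¹ * (1 - Matrix.diagonal ξ) with hΨdef
  have hΨ : Ψ ∈ rowStochastic ℝ (Fin n) := inv_mul_mem_rowStochastic hW0 hW1 hξ hA2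
  have hU := (Matrix.isUnit_iff_isUnit_det _).1 (isUnit_one_sub_of_assumption2 hW0 hW1 hξ hA2)
  have hΨcol (i j : Fin n) (hj : ¬ ξ j < 1) : Ψ i j = 0 := by
    have : ξ j = 1 := le_antisymm (hξ j).2 (not_lt.1 hj)
    rw [hΨdef, mul_sub, mul_one, Matrix.sub_apply, Matrix.mul_diagonal, this, mul_one, sub_self]
  have hΨrec (i j : Fin n) : Ψ i j = (1 - Matrix.diagonal ξ) i j + ξ i * ∑ k, W i k * Ψ k j := by
    have h : (1 - Matrix.diagonal ξ * W) * Ψ = 1 - Matrix.diagonal ξ :=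
      Matrix.mul_nonsing_inv_cancel_left _ _ hU
    rw [← h, sub_mul, one_mul, Matrix.sub_apply, Matrix.mul_assoc, Matrix.diagonal_mul,
      Matrix.mul_apply]
    ring
  have hsum (i j : Fin n) : 0 ≤ ∑ k, W i k * Ψ k j :=
    Finset.sum_nonneg fun k _ => mul_nonneg (hW0 i k) (hΨ.1 k j)
  have hΨdiag (i : Fin n) (hi : ξ i < 1) : 0 < Ψ i i := by
    rw [hΨrec, Matrix.sub_apply, Matrix.one_apply_eq, Matrix.diagonal_apply_eq]
    linarith [mul_nonneg (hξ i).1 (hsum i i)]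
  have hΨedge (i j : Fin n) (hi : 0 < ξ i) (hj : ξ j < 1) (hij : 0 < W i j) : 0 < Ψ i j := by
    have h₁ : 0 < ∑ k, W i k * Ψ k j := Finset.sum_pos' (fun k _ => mul_nonneg (hW0 i k) (hΨ.1 k j))
      ⟨j, Finset.mem_univ j, mul_pos hij (hΨdiag j hj)⟩
    have h₂ : 0 ≤ (1 - Matrix.diagonal ξ) i j := by
      rw [Matrix.sub_apply, Matrix.one_apply, Matrix.diagonal_apply]
      split_ifs <;> simp [(hξ i).2]
    rw [hΨrec]
    linarith [mul_pos hi h₁]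
  have hΦ : H * Ψ ∈ rowStochastic ℝ (Fin n) :=
    mul_mem (mem_rowStochastic_iff_sum.2 ⟨hH0, hH1⟩) hΨ
  have hstoch : (∀ a b, 0 ≤ Φ₁ a b) ∧ (∀ a, ∑ b, Φ₁ a b = 1) := by
    refine ⟨fun a b => hΦ₁ a b ▸ hΦ.1 a.1 b.1, fun a => ?_⟩
    refine Eq.trans ?_ (sum_row_of_mem_rowStochastic hΦ a.1)
    simp_rw [hΦ₁]
    rw [← Finset.sum_subtype (Finset.univ.filter fun i => ξ i < 1) (by simp)
      fun i => (H * Ψ) a.1 i]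
    refine Finset.sum_filter_of_ne fun j _ hne => ?_
    by_contra hj
    exact hne (by simp [Matrix.mul_apply, hΨcol _ j hj])
  have hpos (a b : {i : Fin n // ξ i < 1}) (k : Fin n) (h₁ : 0 < H a.1 k) (h₂ : 0 < Ψ k b.1) :
      0 < Φ₁ a b := by
    rw [hΦ₁]
    exact (mul_apply_pos_iff_exists hH0 hΨ.1).2 ⟨k, h₁, h₂⟩
  have hedge (a b : {i : Fin n // ξ i < 1}) (h : 0 < Φ' a b) : 0 < Φ₁ a b := by
    rw [hΦ'] at h
    split_ifs at h with ha
    · exact hpos a b b h (hΨdiag b b.2)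
    · exact hpos a b a (hHd a) (hΨedge a b ((hξ a).1.lt_of_ne' ha) b.2 h)
  have hΦ'0 (a b : {i : Fin n // ξ i < 1}) : 0 ≤ Φ' a b := by
    rw [hΦ']
    split_ifs
    exacts [hH0 _ _, hW0 _ _]
  obtain ⟨r, hr⟩ := htree
  obtain ⟨N, hN⟩ := exists_pow_apply_pos_of_reachable hstoch.1
    (hpos r r r (hHd r) (hΨdiag r r.2)) (r := r) fun v => by
      rcases eq_or_ne v r with rfl | hv
      · exact ⟨0, by simp⟩
      · obtain ⟨m, -, hm⟩ := hr v hv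
        exact ⟨m, pow_apply_pos_of_apply_pos_imp hΦ'0 hstoch.1 hedge m hm⟩
  exact ⟨hstoch, exists_tendsto_pow_of_pos_column (mem_rowStochastic_iff_sum.2 hstoch) hN⟩
end

section
/- (One-step estimate underlying Lemma 5) For all i, j ∈ V with |y_i − y_j| < d and h·|N_{ij}| ≤ 1, where N_{ij} = N_i ∩ N_j, the updated values satisfy |x_i − x_j| ≤ (1 − h·|N_{ij}|)·|y_i − y_j| + h·(|N_i| + |N_j| − 2·|N_{ij}|)·d. -/
open Matrix Filter Finset

/-- `Nb y d i` is the set of agents within confidence distance `d` of agent `i`. -/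
noncomputable def Nb {n : ℕ} (y : Fin n → ℝ) (d : ℝ) (i : Fin n) : Finset (Fin n) :=
  Finset.univ.filter fun l => |y i - y l| < d

/-- One bounded-confidence averaging step: `x i = y i + h ∑_{l ∈ N_i} (y l - y i)`. -/
noncomputable def bcStep {n : ℕ} (y : Fin n → ℝ) (d h : ℝ) (i : Fin n) : ℝ :=
  y i + h * ∑ l ∈ Nb y d i, (y l - y i)

/-- Splitting a neighborhood sum over the part shared with a set `t`. -/
theorem sum_sub_eq_inter_add_sdiff {ι : Type*} [DecidableEq ι] (s t : Finset ι) (f : ι → ℝ)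
    (a : ℝ) :
    ∑ l ∈ s, (f l - a) =
      (∑ l ∈ s ∩ t, f l - ((s ∩ t).card : ℝ) * a) + ∑ l ∈ s \ t, (f l - a) := by
  rw [← Finset.sum_inter_add_sum_sdiff s t, Finset.sum_sub_distrib, Finset.sum_const,
    nsmul_eq_mul]

theorem card_sdiff_eq_sub_inter {ι : Type*} [DecidableEq ι] (s t : Finset ι) :
    ((s \ t).card : ℝ) = (s.card : ℝ) - ((s ∩ t).card : ℝ) := by
  rw [eq_sub_iff_add_eq]
  exact_mod_cast Finset.card_sdiff_add_card_inter s t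

theorem abs_sum_sdiff_Nb_le {n : ℕ} (y : Fin n → ℝ) (d : ℝ) (i : Fin n) (t : Finset (Fin n)) :
    |∑ l ∈ Nb y d i \ t, (y l - y i)| ≤
      (((Nb y d i).card : ℝ) - ((Nb y d i ∩ t).card : ℝ)) * d := by
  rw [← card_sdiff_eq_sub_inter, ← nsmul_eq_mul]
  refine (Finset.abs_sum_le_sum_abs _ _).trans (Finset.sum_le_card_nsmul _ _ _ fun l hl => ?_)
  have hl' := (Finset.mem_sdiff.mp hl).1
  simp only [Nb, Finset.mem_filter, Finset.mem_univ, true_and] at hl'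
  rw [abs_sub_comm]
  exact hl'.le

/-- One-step estimate underlying Lemma 5. -/
theorem bc_one_step_estimate
    (n : ℕ) (y : Fin n → ℝ) (d h : ℝ) (hd : 0 < d) (hh : 0 < h)
    (i j : Fin n) (hij : |y i - y j| < d)
    (hcard : h * ((Nb y d i ∩ Nb y d j).card : ℝ) ≤ 1) :
    |bcStep y d h i - bcStep y d h j| ≤
      (1 - h * ((Nb y d i ∩ Nb y d j).card : ℝ)) * |y i - y j| +
        h * (((Nb y d i).card : ℝ) + ((Nb y d j).card : ℝ) -
          2 * ((Nb y d i ∩ Nb y d j).card : ℝ)) * d := by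
  have hi := abs_sum_sdiff_Nb_le y d i (Nb y d j)
  have hj := abs_sum_sdiff_Nb_le y d j (Nb y d i)
  have hsi := sum_sub_eq_inter_add_sdiff (Nb y d i) (Nb y d j) y (y i)
  have hsj := sum_sub_eq_inter_add_sdiff (Nb y d j) (Nb y d i) y (y j)
  rw [Finset.inter_comm (Nb y d j)] at hj hsj
  set c : ℝ := ((Nb y d i ∩ Nb y d j).card : ℝ)
  set A := ∑ l ∈ Nb y d i \ Nb y d j, (y l - y i)
  set B := ∑ l ∈ Nb y d j \ Nb y d i, (y l - y j)
  have key : bcStep y d h i - bcStep y d h j = (1 - h * c) * (y i - y j) + h * (A - B) := by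
    simp only [bcStep, hsi, hsj]
    ring
  have hAB : |A - B| ≤ ((Nb y d i).card + (Nb y d j).card - 2 * c) * d := by
    linarith [abs_sub A B]
  calc |bcStep y d h i - bcStep y d h j|
      ≤ |(1 - h * c) * (y i - y j)| + |h * (A - B)| := key ▸ abs_add_le _ _
    _ = (1 - h * c) * |y i - y j| + h * |A - B| := by
      rw [abs_mul, abs_mul, abs_of_nonneg (sub_nonneg.mpr hcard), abs_of_pos hh]
    _ ≤ _ := by
      rw [mul_assoc h]
      gcongr
end

section
/- (Confidence-bound preservation, consequences used in Lemma 5) Suppose 0 < h and h·(n − 1) < 1, and let i, j ∈ V with |y_i − y_j| < d. Then: (a) if |N_{ij}| > n/2 then the updated values satisfy |x_i − x_j| < d; (b) if moreover h·|N_{ij}| ≤ 1 and |N_{ij}| > n/2 + 1/(4h), then |x_i − x_j| < d/2. -/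
open Matrix Filter Finset

/-- Neighbours outside `s` contribute at most `d` each to the averaging sum. -/
theorem abs_sum_Nb_sdiff_le {n : ℕ} (y : Fin n → ℝ) (d : ℝ) (i : Fin n) (s : Finset (Fin n)) :
    |∑ l ∈ Nb y d i \ s, (y l - y i)| ≤ ((Nb y d i \ s).card : ℝ) * d := by
  refine (abs_sum_le_sum_abs _ _).trans ?_
  rw [← nsmul_eq_mul]
  refine sum_le_card_nsmul _ _ _ fun l hl => ?_
  have hl' : |y i - y l| < d := by simpa [Nb] using (mem_sdiff.mp hl).1
  rw [abs_sub_comm]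
  exact hl'.le

theorem abs_bcStep_sub_bcStep_le {n : ℕ} (y : Fin n → ℝ) {d h : ℝ} (hd : 0 ≤ d) (hh : 0 ≤ h)
    (i j : Fin n) :
    |bcStep y d h i - bcStep y d h j| ≤
      |1 - h * ((Nb y d i ∩ Nb y d j).card : ℝ)| * |y i - y j| +
        h * (d * ((n : ℝ) - ((Nb y d i ∩ Nb y d j).card : ℝ))) := by
  have hi := sum_inter_add_sum_sdiff (Nb y d i) (Nb y d j) fun l => y l - y i
  have hj := sum_inter_add_sum_sdiff (Nb y d j) (Nb y d i) fun l => y l - y j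
  rw [inter_comm (Nb y d j)] at hj
  have hcard : ((Nb y d i \ Nb y d j).card : ℝ) + ((Nb y d j \ Nb y d i).card : ℝ) ≤
      (n : ℝ) - ((Nb y d i ∩ Nb y d j).card : ℝ) := by
    have h₁ := card_sdiff_add_card (Nb y d i) (Nb y d j)
    have h₂ := card_sdiff_add_card_inter (Nb y d j) (Nb y d i)
    rw [inter_comm (Nb y d j)] at h₂
    have h₃ := card_le_univ (Nb y d i ∪ Nb y d j)
    rw [Fintype.card_fin] at h₃
    rw [le_sub_iff_add_le]
    exact_mod_cast (by omega : (Nb y d i \ Nb y d j).card + (Nb y d j \ Nb y d i).card +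
      (Nb y d i ∩ Nb y d j).card ≤ n)
  have hdecomp : bcStep y d h i - bcStep y d h j =
      (1 - h * ((Nb y d i ∩ Nb y d j).card : ℝ)) * (y i - y j) +
        h * (∑ l ∈ Nb y d i \ Nb y d j, (y l - y i) -
          ∑ l ∈ Nb y d j \ Nb y d i, (y l - y j)) := by
    rw [bcStep, bcStep, ← hi, ← hj]
    simp only [sum_sub_distrib, sum_const, nsmul_eq_mul]
    ring
  rw [hdecomp]
  refine (abs_add_le _ _).trans ?_
  rw [abs_mul, abs_mul h, abs_of_nonneg hh]
  gcongr
  calc _ ≤ _ := abs_sub _ _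
    _ ≤ _ := add_le_add (abs_sum_Nb_sdiff_le y d i _) (abs_sum_Nb_sdiff_le y d j _)
    _ = d * (((Nb y d i \ Nb y d j).card : ℝ) + ((Nb y d j \ Nb y d i).card : ℝ)) := by ring
    _ ≤ _ := by gcongr

/-- Confidence-bound preservation (consequences used in Lemma 5):
(a) if `|N_ij| > n/2` then `|x i - x j| < d`;
(b) if moreover `h|N_ij| ≤ 1` and `|N_ij| > n/2 + 1/(4h)`, then `|x i - x j| < d/2`. -/
theorem bc_confidence_preservation
    (n : ℕ) (y : Fin n → ℝ) (d h : ℝ) (hd : 0 < d)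
    (hh : 0 < h) (hhn : h * ((n : ℝ) - 1) < 1)
    (i j : Fin n) (hij : |y i - y j| < d) :
    (((n : ℝ) / 2 < ((Nb y d i ∩ Nb y d j).card : ℝ)) →
      |bcStep y d h i - bcStep y d h j| < d) ∧
    ((h * ((Nb y d i ∩ Nb y d j).card : ℝ) ≤ 1 →
      (n : ℝ) / 2 + 1 / (4 * h) < ((Nb y d i ∩ Nb y d j).card : ℝ) →
      |bcStep y d h i - bcStep y d h j| < d / 2)) := by
  have key := abs_bcStep_sub_bcStep_le y hd.le hh.le i j
  have hmn : (Nb y d i ∩ Nb y d j).card ≤ n := by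
    simpa using card_le_univ (Nb y d i ∩ Nb y d j)
  generalize (Nb y d i ∩ Nb y d j).card = m at *
  have contract (hm : h * (m : ℝ) ≤ 1) : |bcStep y d h i - bcStep y d h j| ≤
      d * (1 - 2 * (h * m) + h * n) := by
    rw [abs_of_nonneg (sub_nonneg.mpr hm)] at key
    linarith [mul_le_mul_of_nonneg_left hij.le (sub_nonneg.mpr hm)]
  refine ⟨fun hm => ?_, fun hm1 hm => ?_⟩
  · rcases le_or_gt (h * (m : ℝ)) 1 with hm1 | hm1
    · refine (contract hm1).trans_lt (mul_lt_of_lt_one_right hd ?_)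
      linarith [mul_lt_mul_of_pos_left hm hh]
    · have hmn' : m = n := by
        by_contra hne
        have hle : (m : ℝ) ≤ n - 1 := by
          rw [le_sub_iff_add_le]
          exact_mod_cast lt_of_le_of_ne hmn hne
        linarith [mul_le_mul_of_nonneg_left hle hh.le]
      subst hmn'
      rw [abs_of_neg (sub_neg.mpr hm1), sub_self, mul_zero, mul_zero, add_zero] at key
      refine key.trans_lt ?_
      rcases le_or_gt m 1 with h1 | h1
      · have : Subsingleton (Fin m) := Fin.subsingleton_iff_le_one.mpr h1
        simpa [Subsingleton.elim i j] using hd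
      · have h2 : (2 : ℝ) ≤ m := by exact_mod_cast h1
        refine (mul_le_of_le_one_left (abs_nonneg _) ?_).trans_lt hij
        linarith [mul_le_mul_of_nonneg_left h2 hh.le]
  · refine (contract hm1).trans_lt ?_
    have hlt := mul_lt_mul_of_pos_left hm hh
    have hq : h * (1 / (4 * h)) = 1 / 4 := by field_simp
    rw [mul_add, hq] at hlt
    rw [div_eq_mul_inv]
    refine mul_lt_mul_of_pos_left ?_ hd
    linarith
end
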